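/- Let p ∈ {2,3,5,7}, m = 24/(p+1), f(τ) = 1/(η(τ)^m η(pτ)^m), and define T-invariant functions g_j (j = 0,…,p−1) by g_j(τ) = (1/p) Σ_{k=0}^{p−1} e(−kj/p) f((τ+k)/p). Then the lift F = Σ_γ F_γ e^γ of f to the lattice Λ_p ⊕ √p II_{1,1}, defined by F(τ) = Σ_{M ∈ Γ₀(p)\SL₂(ℤ)} f|_M(τ) ρ_D(M⁻¹) e^0, has components F_γ = f + g_0 if γ = 0, and F_γ = g_j if γ ≠ 0 and γ²/2 = −j/p mod 1. Moreover, the components F_γ with γ²/2 = 0 mod 1 are modular forms for Γ₀(p) of weight −m, of nontrivial quadratic character in the case p = 7. -/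

import Mathlib

/-!
STATEMENT 11.
Let p ∈ {2,3,5,7}, m = 24/(p+1), f(τ) = 1/(η(τ)^m η(pτ)^m), and define T-invariant
functions g_j (j = 0,…,p−1) by g_j(τ) = (1/p) Σ_{k=0}^{p−1} e(−kj/p) f((τ+k)/p).  Then
the lift F = Σ_γ F_γ e^γ of f to the lattice Λ_p ⊕ √p II_{1,1}, defined by
F(τ) = Σ_{M ∈ Γ₀(p)\SL₂(ℤ)} f|_M(τ) ρ_D(M⁻¹) e^0, has components F_γ = f + g_0 if
γ = 0, and F_γ = g_j if γ ≠ 0 and γ²/2 = −j/p mod 1.  Moreover, the components F_γ with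
γ²/2 = 0 mod 1 are modular forms for Γ₀(p) of weight −m, of nontrivial quadratic
character in the case p = 7.

Formalization notes.  The discriminant form D of Λ_p ⊕ √p II_{1,1} is axiomatized by
the structure `DiscForm`: a finite abelian group of order p^{m+2} with a ℚ/ℤ-valued
quadratic form (recorded by a representative function qf), nondegenerate, of level p,
whose Gauss sum equals √|D|·e(sign(D)/8) with sign(D) = sign(Λ_p ⊕ √p II_{1,1}) = 2m
mod 8 (Milgram); these invariants characterize this discriminant form.  The lift is
written out explicitly using the standard coset representatives
Γ₀(p)\SL₂(ℤ) = {1, S·T^k (0 ≤ k < p)}: f|_{−m,1}·ρ_D(1)e^0 contributes f·e^0, and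
f|_{−m,S T^k}(τ) = (τ+k)^m f(−1/(τ+k)) with
ρ_D((S T^k)⁻¹) e^0 = (e(−sign(D)/8)/√|D|) Σ_β e(k·β²/2) e^β; `liftF` below is the
resulting e^γ-component.  η is the Dedekind eta function, defined by its product
expansion, and for p = 7 the character is the Legendre symbol d ↦ (d/7).
-/

open scoped BigOperators Classical MatrixGroups

/-- `ee x = e^{2πix}`. -/
noncomputable def ee (x : ℂ) : ℂ := Complex.exp (2 * Real.pi * Complex.I * x)

/-- The Dedekind eta function `η(τ) = e^{πiτ/12} ∏_{n≥1} (1 − e^{2πinτ})`. -/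
noncomputable def eta (τ : ℂ) : ℂ :=
  Complex.exp (Real.pi * Complex.I * τ / 12) * ∏' n : ℕ, (1 - ee ((n + 1) * τ))

/-- The eta product `f(τ) = 1/(η(τ)^m η(pτ)^m)`. -/
noncomputable def fEta (p m : ℕ) (τ : ℂ) : ℂ :=
  1 / (eta τ ^ m * eta ((p : ℂ) * τ) ^ m)

/-- `g_j(τ) = (1/p) Σ_{k=0}^{p−1} e(−kj/p) f((τ+k)/p)`. -/
noncomputable def gComp (p m j : ℕ) (τ : ℂ) : ℂ :=
  (1 / (p : ℂ)) * ∑ k ∈ Finset.range p,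
    ee (-(((k * j : ℕ) : ℚ) / p : ℚ)) * fEta p m ((τ + k) / p)

/-- The character `d ↦ (d/7)` of `Γ₀(7)` given by the Legendre symbol. -/
noncomputable def chiSeven (d : ℤ) : ℤ := @legendreSym 7 ⟨by norm_num⟩ d

/-- The discriminant form `D = L'/L` of the lattice `L = Λ_p ⊕ √p II_{1,1}`,
axiomatized by its characterizing invariants: a finite abelian group of order
`p^{m+2}`, with quadratic form `γ ↦ γ²/2 ∈ ℚ/ℤ` (recorded by a representative
function `qf`), which is quadratic and nondegenerate mod 1, of level `p`, and whose
Gauss sum is `√|D|·e(sign(D)/8)` with `sign(D) = 2m mod 8` (Milgram formula, the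
signature of `Λ_p ⊕ √p II_{1,1}` being `(2m+1) − 1 = 2m`). -/
structure DiscForm (p m : ℕ) where
  D : Type
  [grp : AddCommGroup D]
  [fin : Fintype D]
  qf : D → ℚ
  card_eq : Fintype.card D = p ^ (m + 2)
  level : ∀ γ, ∃ z : ℤ, (z : ℚ) = (p : ℚ) * qf γ
  qf_quadratic : ∀ (n : ℤ) (γ : D), ∃ z : ℤ, (z : ℚ) = qf (n • γ) - (n : ℚ) ^ 2 * qf γ
  bilin_shift : ∀ γ β : D, ∃ z : ℤ, (z : ℚ) = (p : ℚ) * (qf (γ + β) - qf γ - qf β)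
  nondeg : ∀ γ : D, γ ≠ 0 → ∃ β : D, ¬ ∃ z : ℤ, (z : ℚ) = qf (γ + β) - qf γ - qf β
  gauss : (∑ γ : D, ee (qf γ)) = ((Real.sqrt ((p : ℝ) ^ (m + 2)) : ℝ) : ℂ)
      * ee (((2 * m : ℕ) : ℚ) / 8)

attribute [instance] DiscForm.grp DiscForm.fin

/-- The `e^γ`-component of the lift `F(τ) = Σ_{M ∈ Γ₀(p)\SL₂(ℤ)} f|_M(τ) ρ_D(M⁻¹) e^0`
of `f` (in weight `−m`), written out over the coset representatives `1, S·T^k`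
(`0 ≤ k < p`) of `Γ₀(p)\SL₂(ℤ)`. -/
noncomputable def liftF (p m : ℕ) (Dd : DiscForm p m) (γ : Dd.D) (τ : ℂ) : ℂ :=
  (if γ = 0 then fEta p m τ else 0)
    + (ee (-(((2 * m : ℕ) : ℚ) / 8)) / ((Real.sqrt ((p : ℝ) ^ (m + 2)) : ℝ) : ℂ))
      * ∑ k ∈ Finset.range p,
          (τ + k) ^ m * fEta p m (-1 / (τ + k)) * ee ((k : ℚ) * Dd.qf γ)

section EtaProduct

lemma eta_eq_modularForm_eta (τ : ℂ) : eta τ = ModularForm.eta τ := by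
  unfold eta ModularForm.eta
  congr 1
  · rw [Function.Periodic.qParam]
    congr 1
    push_cast
    ring
  · refine tprod_congr fun n => ?_
    rw [ModularForm.eta_q_eq_cexp, ee]
    congr 2
    ring

lemma eta_ne_zero {τ : ℂ} (hτ : 0 < τ.im) : eta τ ≠ 0 := by
  rw [eta_eq_modularForm_eta]
  exact ModularForm.eta_ne_zero hτ

lemma continuousAt_eta {τ : ℂ} (hτ : 0 < τ.im) : ContinuousAt eta τ := by
  rw [show eta = ModularForm.eta from funext eta_eq_modularForm_eta]
  exact (ModularForm.differentiableAt_eta_of_mem_upperHalfPlaneSet hτ).continuousAt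

lemma eta_add_natCast (τ : ℂ) (n : ℕ) :
    eta (τ + n) = Complex.exp (n * (Real.pi * Complex.I / 12)) * eta τ := by
  unfold eta
  rw [← mul_assoc, ← Complex.exp_add]
  congr 1
  · congr 1
    ring
  · refine tprod_congr fun k => ?_
    rw [ee, ee, show 2 * Real.pi * Complex.I * (((k : ℂ) + 1) * (τ + n))
      = 2 * Real.pi * Complex.I * (((k : ℂ) + 1) * τ)
        + (((k + 1) * n : ℕ) : ℂ) * (2 * Real.pi * Complex.I) by push_cast; ring,
      Complex.exp_add, Complex.exp_nat_mul_two_pi_mul_I, mul_one]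

lemma eta_neg_one_div {τ : ℂ} (hτ : 0 < τ.im) :
    eta (-1 / τ) = (Complex.sqrt Complex.I)⁻¹ * (Complex.sqrt τ * eta τ) := by
  simpa [eta_eq_modularForm_eta] using ModularForm.eta_comp_eq_csqrt_I_inv hτ

lemma fEta_ne_zero {p : ℕ} (hp : 0 < p) (m : ℕ) {τ : ℂ} (hτ : 0 < τ.im) : fEta p m τ ≠ 0 := by
  have h : 0 < ((p : ℂ) * τ).im := by simpa using mul_pos (Nat.cast_pos.mpr hp) hτ
  exact one_div_ne_zero (mul_ne_zero (pow_ne_zero _ (eta_ne_zero hτ))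
    (pow_ne_zero _ (eta_ne_zero h)))

lemma continuousAt_fEta {p : ℕ} (hp : 0 < p) (m : ℕ) {τ : ℂ} (hτ : 0 < τ.im) :
    ContinuousAt (fEta p m) τ := by
  have h : 0 < ((p : ℂ) * τ).im := by simpa using mul_pos (Nat.cast_pos.mpr hp) hτ
  have h' : ContinuousAt (fun τ : ℂ => eta ((p : ℂ) * τ)) τ :=
    ContinuousAt.comp (f := fun τ : ℂ => (p : ℂ) * τ) (continuousAt_eta h) (by fun_prop)
  exact continuousAt_const.div (((continuousAt_eta hτ).pow m).mul (h'.pow m))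
    (mul_ne_zero (pow_ne_zero _ (eta_ne_zero hτ)) (pow_ne_zero _ (eta_ne_zero h)))

lemma fEta_add_one {p m : ℕ} (hm : (p + 1) * m = 24) (τ : ℂ) :
    fEta p m (τ + 1) = fEta p m τ := by
  have h1 := eta_add_natCast τ 1
  rw [Nat.cast_one] at h1
  unfold fEta
  rw [mul_add, mul_one, h1, eta_add_natCast, mul_pow, mul_pow, ← Complex.exp_nat_mul,
    ← Complex.exp_nat_mul, mul_mul_mul_comm, ← Complex.exp_add]
  have hm' : ((p : ℂ) + 1) * m = 24 := mod_cast hm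
  rw [show (m : ℂ) * (1 * (Real.pi * Complex.I / 12))
      + m * (p * (Real.pi * Complex.I / 12)) = 2 * Real.pi * Complex.I by
    linear_combination (Real.pi * Complex.I / 12) * hm', Complex.exp_two_pi_mul_I, one_mul]

lemma fEta_add_intCast {p m : ℕ} (hm : (p + 1) * m = 24) (τ : ℂ) (n : ℤ) :
    fEta p m (τ + n) = fEta p m τ := by
  have h : Function.Periodic (fEta p m) 1 := fEta_add_one hm
  simpa using h.int_mul n τ

lemma Complex.sqrt_sq (z : ℂ) : Complex.sqrt z ^ 2 = z := by
  simp [Complex.sqrt]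

lemma Complex.sqrt_div_natCast {p : ℕ} (hp : 0 < p) {z : ℂ} (hz : z ≠ 0) :
    Complex.sqrt (z / p) = Complex.sqrt z / (Real.sqrt p : ℂ) := by
  have hp' : (0 : ℝ) < (p : ℝ)⁻¹ := inv_pos.mpr (Nat.cast_pos.mpr hp)
  rw [_root_.sqrt_eq_exp hz, _root_.sqrt_eq_exp (div_ne_zero hz (by simpa using hp.ne')),
    show z / p = (((p : ℝ)⁻¹ : ℝ) : ℂ) * z by push_cast; ring, Complex.log_ofReal_mul hp' hz,
    Real.log_inv, add_div, Complex.exp_add, Real.sqrt_eq_rpow,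
    Real.rpow_def_of_pos (Nat.cast_pos.mpr hp), Complex.ofReal_exp]
  rw [mul_comm, ← Complex.exp_add, ← Complex.exp_sub]
  congr 1
  push_cast
  ring

lemma pow_mul_fEta_neg_one_div {p : ℕ} (hp : 0 < p) (m : ℕ) {τ : ℂ} (hτ : 0 < τ.im) :
    τ ^ m * fEta p m (-1 / τ) = Complex.I ^ m * (Real.sqrt p : ℂ) ^ m * fEta p m (τ / p) := by
  have hτ0 : τ ≠ 0 := by rintro rfl; simp at hτ
  have hp0 : (p : ℂ) ≠ 0 := by simpa using hp.ne'
  have hsp : (Real.sqrt p : ℂ) ≠ 0 := by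
    simpa using (Real.sqrt_pos.mpr (Nat.cast_pos.mpr hp)).ne'
  have him : 0 < (τ / p).im := by
    simpa using div_pos hτ (Nat.cast_pos.mpr hp)
  have h1 := eta_neg_one_div hτ
  have h2 := eta_neg_one_div him
  have hI : Complex.sqrt Complex.I ≠ 0 := fun h => Complex.I_ne_zero (by
    rw [← Complex.sqrt_sq Complex.I, h]; simp)
  unfold fEta
  rw [show (p : ℂ) * (-1 / τ) = -1 / (τ / p) by field_simp, h1, h2,
    Complex.sqrt_div_natCast hp hτ0, show (p : ℂ) * (τ / p) = τ by field_simp,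
    ← mul_pow, ← mul_pow, ← mul_pow, mul_one_div, mul_one_div, ← div_pow, ← div_pow]
  congr 1
  have e1 := eta_ne_zero hτ
  have e2 := eta_ne_zero him
  have hsτ : Complex.sqrt τ ≠ 0 := fun h => hτ0 (by rw [← Complex.sqrt_sq τ, h]; simp)
  have i1 := Complex.sqrt_sq Complex.I
  have i2 := Complex.sqrt_sq τ
  field_simp
  rw [i1, i2]

end EtaProduct

section Generators

open ModularGroup

lemma exists_T_zpow_of_lower_left_eq_zero {A : SL(2, ℤ)} (hc : A 1 0 = 0) :
    ∃ n : ℤ, A = T ^ n ∨ A = -T ^ n := by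
  have hdet := A.det_coe
  rw [Matrix.det_fin_two, hc, mul_zero, sub_zero] at hdet
  rcases Int.mul_eq_one_iff_eq_one_or_neg_one.mp hdet with ⟨ha, hd⟩ | ⟨ha, hd⟩
  · refine ⟨A 0 1, Or.inl ?_⟩
    ext i j
    rw [coe_T_zpow]
    fin_cases i <;> fin_cases j <;> simp [ha, hc, hd]
  · refine ⟨-A 0 1, Or.inr ?_⟩
    ext i j
    rw [Matrix.SpecialLinearGroup.coe_neg, coe_T_zpow]
    fin_cases i <;> fin_cases j <;> simp [ha, hc, hd]

lemma mem_Gamma0_iff_dvd {p : ℕ} {A : SL(2, ℤ)} :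
    A ∈ CongruenceSubgroup.Gamma0 p ↔ (p : ℤ) ∣ A 1 0 := by
  rw [CongruenceSubgroup.Gamma0_mem, ZMod.intCast_zmod_eq_zero_iff_dvd]

/-- A Euclidean step: if `p * c` and `d` are coprime, adding to `d` some multiple of `c ≠ 0`, by an
integer not divisible by `p`, brings it below `c` in absolute value. -/
lemma exists_not_dvd_natAbs_lt {p : ℕ} (hp : 1 < p) {c d : ℤ} (hc : c ≠ 0)
    (hd : IsCoprime ((p : ℤ) * c) d) :
    ∃ x : ℤ, ¬ (p : ℤ) ∣ x ∧ (x * c + d).natAbs < c.natAbs := by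
  have hp1 : ¬ (p : ℤ) ∣ 1 := fun h => by
    have := Int.le_of_dvd one_pos h
    lia
  have hr0 := Int.emod_nonneg d hc
  have hr1 := Int.emod_lt_abs d hc
  rw [Int.abs_eq_natAbs] at hr1
  have hdm := Int.mul_ediv_add_emod d c
  by_cases hx : (p : ℤ) ∣ -(d / c)
  · have hrpos : d % c ≠ 0 := fun h0 => by
      have hpd : (p : ℤ) ∣ d := by
        rw [← hdm, h0, add_zero]
        exact (dvd_neg.mp hx).mul_left c
      exact hp1 (isUnit_iff_dvd_one.mp (hd.isUnit_of_dvd' (dvd_mul_right _ _) hpd))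
    refine ⟨-(d / c) - c.sign, fun h => ?_, ?_⟩
    · have h' := (dvd_sub_right hx).mp h
      rcases lt_or_gt_of_ne hc with hc' | hc'
      · exact hp1 (by simpa [Int.sign_eq_neg_one_of_neg hc'] using h')
      · exact hp1 (by simpa [Int.sign_eq_one_of_pos hc'] using h')
    · have : (-(d / c) - c.sign) * c + d = d % c - c.natAbs := by
        rw [← Int.sign_mul_self]
        linear_combination -hdm
      rw [this]
      lia
  · refine ⟨-(d / c), hx, ?_⟩
    have : -(d / c) * c + d = d % c := by linear_combination -hdm
    rw [this]
    lia

/-- `Γ₀(p)` is generated by `-1`, `T` and matrices with lower left entry `p`, one for each residue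
class modulo `p` of the upper left entry. -/
lemma Gamma0_le_of_mem {p : ℕ} (hp : 1 < p) {H : Subgroup SL(2, ℤ)} (hT : T ∈ H) (hneg : -1 ∈ H)
    (hW : ∀ x : ℤ, ¬ (p : ℤ) ∣ x → ∃ W ∈ H, W 1 0 = p ∧ (p : ℤ) ∣ x - W 0 0) :
    CongruenceSubgroup.Gamma0 p ≤ H := by
  suffices h : ∀ n : ℕ, ∀ A : SL(2, ℤ), ∀ c : ℤ, A 1 0 = p * c → c.natAbs = n → A ∈ H by
    intro A hA
    obtain ⟨c, hc⟩ := mem_Gamma0_iff_dvd.mp hA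
    exact h _ A c hc rfl
  intro n
  induction n using Nat.strong_induction_on with
  | _ n ih =>
    intro A c hAc hcn
    rcases eq_or_ne c 0 with rfl | hc
    · obtain ⟨k, rfl | rfl⟩ := exists_T_zpow_of_lower_left_eq_zero (by simpa using hAc)
      · exact H.zpow_mem hT k
      · rw [← neg_one_mul]
        exact H.mul_mem hneg (H.zpow_mem hT k)
    · have hcop : IsCoprime ((p : ℤ) * c) (A 1 1) := by
        rw [← hAc]
        refine ⟨-A 0 1, A 0 0, ?_⟩
        have := A.det_coe
        rw [Matrix.det_fin_two] at this
        linear_combination this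
      obtain ⟨x, hx, hlt⟩ := exists_not_dvd_natAbs_lt hp hc hcop
      obtain ⟨W, hWH, hWp, k, hk⟩ := hW x hx
      have hV : T ^ k * W ∈ H := H.mul_mem (H.zpow_mem hT k) hWH
      refine (H.mul_mem_cancel_right hV).mp (ih _ (hcn ▸ hlt) (A * (T ^ k * W)) _ ?_ rfl)
      simp only [Matrix.SpecialLinearGroup.coe_mul, coe_T_zpow, Matrix.mul_apply, Fin.sum_univ_two,
        Matrix.of_apply, Matrix.cons_val', Matrix.cons_val_zero, Matrix.cons_val_one,
        Matrix.cons_val_fin_one, hAc, hWp]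
      linear_combination (-(p : ℤ) * c) * hk

end Generators

section Modularity

open UpperHalfPlane ModularGroup
open scoped ModularForm

lemma coe_SL_smul (A : SL(2, ℤ)) (τ : ℍ) :
    ((A • τ : ℍ) : ℂ) = ((A 0 0 : ℂ) * τ + A 0 1) / ((A 1 0 : ℂ) * τ + A 1 1) := by
  rw [coe_specialLinearGroup_apply]
  simp

lemma denom_SL (A : SL(2, ℤ)) (τ : ℍ) :
    denom (A : GL (Fin 2) ℝ) τ = (A 1 0 : ℂ) * τ + A 1 1 := by
  simp [denom]

lemma SL_det (A : SL(2, ℤ)) : A 0 0 * A 1 1 - A 0 1 * A 1 0 = 1 := by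
  rw [← Matrix.det_fin_two, A.det_coe]

lemma eta_pow_smul (A : SL(2, ℤ)) (τ : ℍ) :
    eta ((A • τ : ℍ) : ℂ) ^ 24 = ((A 1 0 : ℂ) * τ + A 1 1) ^ 12 * eta τ ^ 24 := by
  have h := congrFun (SlashInvariantForm.slash_action_eqn CuspForm.discriminant
    (A : GL (Fin 2) ℝ) ⟨A, rfl⟩) τ
  rw [← ModularForm.SL_slash, ModularForm.SL_slash_apply, CuspForm.coe_discriminant,
    ModularForm.discriminant, ModularForm.discriminant, denom_SL] at h
  have hd : (A 1 0 : ℂ) * τ + A 1 1 ≠ 0 := denom_SL A τ ▸ denom_ne_zero _ _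
  rw [eta_eq_modularForm_eta, eta_eq_modularForm_eta, ← h, zpow_neg]
  rw [show ((12 : ℤ)) = ((12 : ℕ) : ℤ) from rfl, zpow_natCast]
  field_simp

/-- The eta product as a function on the upper half-plane. -/
noncomputable def etaProduct (p m : ℕ) (τ : ℍ) : ℂ := fEta p m τ

lemma etaProduct_pow {p m : ℕ} (hm : (p + 1) * m = 24) (τ : ℍ) :
    etaProduct p m τ ^ (p + 1) = 1 / (eta τ ^ 24 * eta ((p : ℂ) * τ) ^ 24) := by
  rw [etaProduct, fEta, div_pow, one_pow, mul_pow, ← pow_mul, ← pow_mul, mul_comm m, hm]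

lemma etaProduct_pow_smul {p m : ℕ} (hp : 0 < p) (hm : (p + 1) * m = 24) {A : SL(2, ℤ)}
    (hA : A ∈ CongruenceSubgroup.Gamma0 p) (τ : ℍ) :
    (etaProduct p m (A • τ) * ((A 1 0 : ℂ) * τ + A 1 1) ^ m) ^ (p + 1)
      = etaProduct p m τ ^ (p + 1) := by
  obtain ⟨c, hc⟩ := mem_Gamma0_iff_dvd.mp hA
  have hdet := SL_det A
  let B : SL(2, ℤ) := ⟨!![A 0 0, p * A 0 1; c, A 1 1], by
    rw [Matrix.det_fin_two_of]; linear_combination hdet + A 0 1 * hc⟩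
  let σ : ℍ := ⟨(p : ℂ) * τ, by simpa using mul_pos (Nat.cast_pos.mpr hp) τ.im_pos⟩
  have hσ : (σ : ℂ) = (p : ℂ) * τ := rfl
  have hd : (A 1 0 : ℂ) * τ + A 1 1 ≠ 0 := denom_SL A τ ▸ denom_ne_zero _ _
  have hden : (B 1 0 : ℂ) * σ + B 1 1 = (A 1 0 : ℂ) * τ + A 1 1 := by
    simp only [B, hσ, hc, Matrix.of_apply, Matrix.cons_val', Matrix.cons_val_zero,
      Matrix.cons_val_one, Matrix.cons_val_fin_one]
    push_cast
    ring
  have hB : ((B • σ : ℍ) : ℂ) = (p : ℂ) * ((A • τ : ℍ) : ℂ) := by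
    rw [coe_SL_smul, coe_SL_smul, hden]
    simp only [B, hσ, Matrix.of_apply, Matrix.cons_val', Matrix.cons_val_zero,
      Matrix.cons_val_one, Matrix.cons_val_fin_one]
    push_cast
    ring
  rw [mul_pow, etaProduct_pow hm, etaProduct_pow hm, ← hB, eta_pow_smul, eta_pow_smul, hden, hσ,
    ← pow_mul, mul_comm m, hm]
  have e1 := eta_ne_zero τ.im_pos
  have e2 := eta_ne_zero σ.im_pos
  rw [hσ] at e2
  field_simp

lemma continuous_etaProduct {p : ℕ} (hp : 0 < p) (m : ℕ) : Continuous (etaProduct p m) :=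
  continuous_iff_continuousAt.mpr fun τ =>
    (continuousAt_fEta hp m τ.im_pos).comp continuous_coe.continuousAt

/-- The quotient `(f|A) / f` takes values in the roots of unity, hence is constant, and it equals
`ζ ^ m` at a fixed point of `A` with automorphy factor `ζ`. -/
lemma etaProduct_slash_eq_of_elliptic {p m : ℕ} (hp : 0 < p) (hm : (p + 1) * m = 24)
    {A : SL(2, ℤ)} (hA : A ∈ CongruenceSubgroup.Gamma0 p) (hc : 0 < A 1 0) {ζ : ℂ}
    (hζ : 0 < ζ.im) (hζA : ζ ^ 2 - (A 0 0 + A 1 1) * ζ + 1 = 0) (hζm : ζ ^ m = 1) :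
    etaProduct p m ∣[(-m : ℤ)] A = etaProduct p m := by
  have hne : ∀ τ : ℍ, etaProduct p m τ ≠ 0 := fun τ => fEta_ne_zero hp m τ.im_pos
  let r : ℍ → ℂ := fun τ =>
    etaProduct p m (A • τ) * ((A 1 0 : ℂ) * τ + A 1 1) ^ m / etaProduct p m τ
  have hr : Continuous r := by
    have hsmul : Continuous fun τ : ℍ => A • τ := continuous_const_smul (A : GL (Fin 2) ℝ)
    refine Continuous.div ?_ (continuous_etaProduct hp m) hne
    refine ((continuous_etaProduct hp m).comp hsmul).mul ?_
    exact ((continuous_const.mul continuous_coe).add continuous_const).pow m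
  have hrU : Set.MapsTo r Set.univ {z : ℂ | z ^ (p + 1) = 1} := fun τ _ => by
    simp only [r, Set.mem_ofPred_eq]
    rw [div_pow, etaProduct_pow_smul hp hm hA, div_self (pow_ne_zero _ (hne τ))]
  have hfin : {z : ℂ | z ^ (p + 1) = 1}.Finite := by
    refine ((Polynomial.nthRoots (p + 1) (1 : ℂ)).toFinset.finite_toSet).subset fun z hz => ?_
    simpa [Polynomial.mem_nthRoots] using hz
  have hconst : ∀ τ τ' : ℍ, r τ = r τ' := fun τ τ' =>
    isPreconnected_univ.constant_of_mapsTo hfin.isDiscrete hr.continuousOn hrU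
      (Set.mem_univ τ) (Set.mem_univ τ')
  have hc' : (A 1 0 : ℂ) ≠ 0 := by exact_mod_cast hc.ne'
  let τ₀ : ℍ := ⟨(ζ - A 1 1) / (A 1 0 : ℤ), by
    rw [Complex.div_intCast_im]
    simpa using div_pos hζ (Int.cast_pos.mpr hc)⟩
  have hτ₀ : (τ₀ : ℂ) = (ζ - A 1 1) / (A 1 0 : ℤ) := rfl
  have hden : (A 1 0 : ℂ) * τ₀ + A 1 1 = ζ := by
    rw [hτ₀]
    field_simp
    ring
  have hζ0 : ζ ≠ 0 := by rintro rfl; simp at hζ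
  have hdet : (A 0 0 : ℂ) * A 1 1 - A 0 1 * A 1 0 = 1 := by exact_mod_cast SL_det A
  have hfix : A • τ₀ = τ₀ := by
    apply UpperHalfPlane.ext
    rw [coe_SL_smul, hden, hτ₀]
    field_simp
    linear_combination -hζA - hdet
  have hr₀ : r τ₀ = 1 := by
    simp only [r]
    rw [hfix, hden, hζm, mul_one, div_self (hne _)]
  ext τ
  have := (hconst τ τ₀).trans hr₀
  simp only [r] at this
  rw [div_eq_one_iff_eq (hne τ)] at this
  rw [ModularForm.SL_slash_apply, denom_SL, neg_neg, zpow_natCast, this]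

lemma etaProduct_slash_T {p m : ℕ} (hm : (p + 1) * m = 24) :
    etaProduct p m ∣[(-m : ℤ)] T = etaProduct p m := by
  ext τ
  rw [ModularForm.SL_slash_apply, denom_SL, etaProduct, coe_SL_smul]
  simp [T, etaProduct, fEta_add_one hm]

/-- The matrix `(1 0; n 1)`. -/
def lowerUnipotent (n : ℤ) : SL(2, ℤ) := ⟨!![1, 0; n, 1], by simp⟩

lemma etaProduct_slash_lowerUnipotent {p m : ℕ} (hp : 0 < p) (hm : (p + 1) * m = 24) :
    etaProduct p m ∣[(-m : ℤ)] lowerUnipotent p = etaProduct p m := by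
  ext τ
  set σ : ℍ := lowerUnipotent p • τ with hσ
  have hσc : (σ : ℂ) = τ / (p * τ + 1) := by
    rw [hσ, coe_SL_smul]
    simp [lowerUnipotent]
  have hden : denom (lowerUnipotent p : GL (Fin 2) ℝ) τ = p * τ + 1 := by
    rw [denom_SL]
    simp [lowerUnipotent]
  have hd : (p : ℂ) * τ + 1 ≠ 0 := hden ▸ denom_ne_zero _ _
  have hp0 : (p : ℂ) ≠ 0 := by simpa using hp.ne'
  have hτ0 := τ.ne_zero
  have him : ∀ z : ℍ, 0 < ((p : ℂ) * z).im := fun z => by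
    simpa using mul_pos (Nat.cast_pos.mpr hp) z.im_pos
  have h1 := pow_mul_fEta_neg_one_div hp m (him τ)
  have h2 := pow_mul_fEta_neg_one_div hp m (him σ)
  rw [mul_div_cancel_left₀ _ hp0] at h1 h2
  have hshift : -1 / ((p : ℂ) * σ) = -1 / (p * τ) + (-1 : ℤ) := by
    rw [hσc]
    field_simp
    push_cast
    ring
  rw [hshift, fEta_add_intCast hm] at h2
  have hC : Complex.I ^ m * (Real.sqrt p : ℂ) ^ m ≠ 0 :=
    mul_ne_zero (pow_ne_zero _ Complex.I_ne_zero) (pow_ne_zero _ (by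
      simpa using (Real.sqrt_pos.mpr (Nat.cast_pos.mpr hp)).ne'))
  rw [ModularForm.SL_slash_apply, ← hσ, hden, neg_neg, zpow_natCast, etaProduct, etaProduct]
  apply mul_left_cancel₀ hC
  rw [← h1, ← mul_assoc, ← h2, hσc, mul_right_comm, ← mul_pow]
  congr 2
  field_simp

/-- The character of `Γ₀(p)`, as a function of the lower right entry. -/
noncomputable def nebentypus (p : ℕ) (d : ℤ) : ℂ := if p = 7 then (chiSeven d : ℂ) else 1

lemma nebentypus_one (p : ℕ) : nebentypus p 1 = 1 := by
  unfold nebentypus chiSeven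
  split_ifs <;> simp

lemma nebentypus_mul (p : ℕ) (a b : ℤ) :
    nebentypus p (a * b) = nebentypus p a * nebentypus p b := by
  unfold nebentypus chiSeven
  split_ifs
  · rw [legendreSym.mul]
    push_cast
    rfl
  · simp

lemma nebentypus_congr {p : ℕ} {a b : ℤ} (h : (p : ℤ) ∣ a - b) :
    nebentypus p a = nebentypus p b := by
  unfold nebentypus chiSeven
  split_ifs with hp
  · subst hp
    have hab : (a : ZMod 7) = b :=
      ((ZMod.intCast_eq_intCast_iff_dvd_sub b a 7).mpr h).symm
    simp only [legendreSym, hab]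
  · rfl

lemma nebentypus_mul_diag {p : ℕ} {A : SL(2, ℤ)} (hA : A ∈ CongruenceSubgroup.Gamma0 p) :
    nebentypus p (A 0 0) * nebentypus p (A 1 1) = 1 := by
  rw [← nebentypus_mul, ← nebentypus_one p]
  refine nebentypus_congr ?_
  have h := SL_det A
  rw [show A 0 0 * A 1 1 - 1 = A 0 1 * A 1 0 by linear_combination h]
  exact (mem_Gamma0_iff_dvd.mp hA).mul_left _

/-- The elements of `Γ₀(p)` under which `f` transforms in weight `k` with character
`nebentypus p`. -/
def transformationSubgroup (p : ℕ) (k : ℤ) (f : ℍ → ℂ) : Subgroup SL(2, ℤ) where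
  carrier := {A | A ∈ CongruenceSubgroup.Gamma0 p ∧ f ∣[k] A = nebentypus p (A 1 1) • f}
  one_mem' := ⟨one_mem _, by simp [nebentypus_one]⟩
  mul_mem' := by
    rintro A B ⟨hA, hfA⟩ ⟨hB, hfB⟩
    refine ⟨mul_mem hA hB, ?_⟩
    rw [SlashAction.slash_mul, hfA, ModularForm.SL_smul_slash, hfB, smul_smul, ← nebentypus_mul]
    congr 1
    refine nebentypus_congr ?_
    rw [Matrix.SpecialLinearGroup.coe_mul, Matrix.mul_apply, Fin.sum_univ_two, sub_add_cancel_right,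
      dvd_neg]
    exact (mem_Gamma0_iff_dvd.mp hA).mul_right _
  inv_mem' := by
    rintro A ⟨hA, hfA⟩
    refine ⟨inv_mem hA, ?_⟩
    have h : f = nebentypus p (A 1 1) • (f ∣[k] A⁻¹) := by
      rw [← ModularForm.SL_smul_slash, ← hfA, ← SlashAction.slash_mul, mul_inv_cancel,
        SlashAction.slash_one]
    have hinv : A⁻¹ 1 1 = A 0 0 := by
      simp [Matrix.SpecialLinearGroup.SL2_inv_expl]
    conv_rhs => rw [hinv, h, smul_smul, nebentypus_mul_diag hA, one_smul]

lemma neg_one_mem_transformationSubgroup {p m : ℕ} (hp : p = 2 ∨ p = 3 ∨ p = 5 ∨ p = 7)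
    (hm : (p + 1) * m = 24) (f : ℍ → ℂ) : -1 ∈ transformationSubgroup p (-m : ℤ) f := by
  refine ⟨mem_Gamma0_iff_dvd.mpr (by simp), ?_⟩
  have hneg : ∀ τ : ℍ, (-1 : SL(2, ℤ)) • τ = τ := fun τ => by
    rw [ModularGroup.SL_neg_smul, one_smul]
  have key : (-1 : ℂ) ^ m = nebentypus p (-1) := by
    unfold nebentypus chiSeven
    rcases hp with rfl | rfl | rfl | rfl
    · obtain rfl : m = 8 := by lia
      norm_num
    · obtain rfl : m = 6 := by lia
      norm_num
    · obtain rfl : m = 4 := by lia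
      norm_num
    · obtain rfl : m = 3 := by lia
      norm_num
  ext τ
  rw [ModularForm.SL_slash_apply, hneg, denom_SL, neg_neg, zpow_natCast]
  simp [← key, mul_comm]

lemma etaProduct_transformation {p m : ℕ} (hp : p = 2 ∨ p = 3 ∨ p = 5 ∨ p = 7)
    (hm : (p + 1) * m = 24) :
    CongruenceSubgroup.Gamma0 p ≤ transformationSubgroup p (-m : ℤ) (etaProduct p m) := by
  have hp0 : 0 < p := by lia
  have hneg := neg_one_mem_transformationSubgroup hp hm (etaProduct p m)
  have hV : lowerUnipotent p ∈ transformationSubgroup p (-m : ℤ) (etaProduct p m) := by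
    refine ⟨mem_Gamma0_iff_dvd.mpr (by simp [lowerUnipotent]), ?_⟩
    rw [etaProduct_slash_lowerUnipotent hp0 hm]
    simp [lowerUnipotent, nebentypus_one]
  have hnegInv : ∀ {W : SL(2, ℤ)}, W ∈ transformationSubgroup p (-m : ℤ) (etaProduct p m) →
      W 1 0 = p → ∃ W' ∈ transformationSubgroup p (-m : ℤ) (etaProduct p m),
        W' 1 0 = p ∧ W' 0 0 = - W 1 1 := by
    intro W hW hWp
    refine ⟨-1 * W⁻¹, mul_mem hneg (inv_mem hW), ?_, ?_⟩ <;>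
      rw [neg_one_mul, Matrix.SpecialLinearGroup.coe_neg, Matrix.neg_apply,
        Matrix.SpecialLinearGroup.SL2_inv_expl] <;>
      simp [hWp]
  refine Gamma0_le_of_mem (by lia) ⟨mem_Gamma0_iff_dvd.mpr (by simp [T]), ?_⟩ hneg fun x hx => ?_
  · rw [etaProduct_slash_T hm]
    simp [T, nebentypus_one]
  obtain ⟨V', hV', hV'p, hV'1⟩ := hnegInv hV (by simp [lowerUnipotent])
  replace hV'1 : V' 0 0 = -1 := by rw [hV'1]; simp [lowerUnipotent]
  have hVp : lowerUnipotent p 1 0 = p := by simp [lowerUnipotent]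
  have hV1 : lowerUnipotent p 0 0 = 1 := by simp [lowerUnipotent]
  by_cases h1 : (p : ℤ) ∣ x - 1
  · exact ⟨_, hV, hVp, by rwa [hV1]⟩
  by_cases h2 : (p : ℤ) ∣ x - (-1)
  · exact ⟨V', hV', hV'p, by rwa [hV'1]⟩
  rcases hp with rfl | rfl | rfl | rfl
  · lia
  · lia
  · obtain rfl : m = 4 := by lia
    have elliptic : ∀ A : SL(2, ℤ), A 1 0 = 5 → A 0 0 + A 1 1 = 0 →
        A ∈ transformationSubgroup 5 (-(4 : ℕ) : ℤ) (etaProduct 5 4) := fun A hc htr => by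
      have hA : A ∈ CongruenceSubgroup.Gamma0 5 := mem_Gamma0_iff_dvd.mpr (by simp [hc])
      refine ⟨hA, ?_⟩
      have htr' : (A 0 0 : ℂ) + A 1 1 = 0 := mod_cast htr
      rw [etaProduct_slash_eq_of_elliptic hp0 hm hA (by lia) (ζ := Complex.I) (by simp)
        (by rw [htr']; simp) Complex.I_pow_four]
      simp [nebentypus]
    by_cases h3 : (5 : ℤ) ∣ x - 2
    · exact ⟨⟨!![2, -1; 5, -2], by decide⟩, elliptic _ rfl rfl, rfl, h3⟩
    · exact ⟨⟨!![-2, -1; 5, 2], by decide⟩, elliptic _ rfl rfl, rfl, by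
        change (5 : ℤ) ∣ x - (-2); lia⟩
  · obtain rfl : m = 3 := by lia
    have elliptic : ∀ A : SL(2, ℤ), A 1 0 = 7 → A 0 0 + A 1 1 = -1 → nebentypus 7 (A 1 1) = 1 →
        A ∈ transformationSubgroup 7 (-(3 : ℕ) : ℤ) (etaProduct 7 3) := fun A hc htr hχ => by
      have hA : A ∈ CongruenceSubgroup.Gamma0 7 := mem_Gamma0_iff_dvd.mpr (by simp [hc])
      refine ⟨hA, ?_⟩
      have htr' : (A 0 0 : ℂ) + A 1 1 = -1 := mod_cast htr
      let ζ : ℂ := ⟨-1 / 2, Real.sqrt 3 / 2⟩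
      have hs : Real.sqrt 3 ^ 2 = 3 := Real.sq_sqrt (by norm_num)
      have hζ : ζ ^ 2 + ζ + 1 = 0 := by
        apply Complex.ext
        · simp [ζ, pow_two]
          linear_combination (-1 / 4) * hs
        · simp [ζ, pow_two]
          ring
      rw [etaProduct_slash_eq_of_elliptic hp0 hm hA (by lia) (ζ := ζ) (by simp [ζ])
        (by rw [htr']; linear_combination hζ) (by linear_combination (ζ - 1) * hζ), hχ, one_smul]
    have h4 : nebentypus 7 4 = 1 := by
      rw [show (4 : ℤ) = 2 * 2 by rfl, nebentypus_mul]
      simp only [nebentypus, chiSeven]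
      norm_num
    have h2 : nebentypus 7 2 = 1 := by
      simp only [nebentypus, chiSeven]
      norm_num
    have hE := elliptic ⟨!![-5, -3; 7, 4], by decide⟩ rfl rfl h4
    have hE' := elliptic ⟨!![-3, -1; 7, 2], by decide⟩ rfl rfl h2
    by_cases h3 : (7 : ℤ) ∣ x - 2
    · exact ⟨_, hE, rfl, by change (7 : ℤ) ∣ x - (-5); lia⟩
    by_cases h5 : (7 : ℤ) ∣ x - 4
    · exact ⟨_, hE', rfl, by change (7 : ℤ) ∣ x - (-3); lia⟩
    by_cases h6 : (7 : ℤ) ∣ x - 3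
    · obtain ⟨W, hW, hWp, hW1⟩ := hnegInv hE rfl
      exact ⟨W, hW, hWp, by rw [hW1]; change (7 : ℤ) ∣ x - (-4); lia⟩
    · obtain ⟨W, hW, hWp, hW1⟩ := hnegInv hE' rfl
      exact ⟨W, hW, hWp, by rw [hW1]; change (7 : ℤ) ∣ x - (-2); lia⟩

lemma fEta_smul {p m : ℕ} (hp : p = 2 ∨ p = 3 ∨ p = 5 ∨ p = 7) (hm : (p + 1) * m = 24)
    {A : SL(2, ℤ)} (hA : A ∈ CongruenceSubgroup.Gamma0 p) (τ : ℍ) :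
    fEta p m ((A • τ : ℍ) : ℂ) = nebentypus p (A 1 1)
      * ((A 1 0 : ℂ) * τ + A 1 1) ^ (-(m : ℤ)) * fEta p m τ := by
  have h := congrFun (etaProduct_transformation hp hm hA).2 τ
  rw [ModularForm.SL_slash_apply, denom_SL, neg_neg, Pi.smul_apply, smul_eq_mul] at h
  have hd : (A 1 0 : ℂ) * τ + A 1 1 ≠ 0 := denom_SL A τ ▸ denom_ne_zero _ _
  rw [mul_right_comm]
  change _ = nebentypus p (A 1 1) * etaProduct p m τ * _
  rw [← h, mul_assoc, ← zpow_add₀ hd, add_neg_cancel, zpow_zero, mul_one]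
  rfl

lemma fEta_smul_add_div {p m : ℕ} (hp : p = 2 ∨ p = 3 ∨ p = 5 ∨ p = 7) (hm : (p + 1) * m = 24)
    {A : SL(2, ℤ)} (hA : A ∈ CongruenceSubgroup.Gamma0 p) (τ : ℍ) {k l : ℤ}
    (hkl : (p : ℤ) ∣ A 0 1 + k * A 1 1 - l * (A 0 0 + k * A 1 0)) :
    fEta p m ((((A • τ : ℍ) : ℂ) + k) / p) = nebentypus p (A 1 1)
      * ((A 1 0 : ℂ) * τ + A 1 1) ^ (-(m : ℤ)) * fEta p m ((τ + l) / p) := by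
  obtain ⟨b, hb⟩ := hkl
  have hp0 : 0 < p := by lia
  have hpc : (p : ℂ) ≠ 0 := by simpa using hp0.ne'
  let B : SL(2, ℤ) := ⟨!![A 0 0 + k * A 1 0, b; p * A 1 0, A 1 1 - l * A 1 0], by
    rw [Matrix.det_fin_two_of]
    linear_combination SL_det A + A 1 0 * hb⟩
  have hB : B ∈ CongruenceSubgroup.Gamma0 p := mem_Gamma0_iff_dvd.mpr (dvd_mul_right _ _)
  let σ : ℍ := ⟨((τ : ℂ) + l) / p, by
    rw [Complex.div_natCast_im]
    simpa using div_pos τ.im_pos (Nat.cast_pos.mpr hp0)⟩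
  have hσ : (σ : ℂ) = ((τ : ℂ) + l) / p := rfl
  have hd : (A 1 0 : ℂ) * τ + A 1 1 ≠ 0 := denom_SL A τ ▸ denom_ne_zero _ _
  have hden : (B 1 0 : ℂ) * σ + B 1 1 = (A 1 0 : ℂ) * τ + A 1 1 := by
    simp only [B, hσ, Matrix.of_apply, Matrix.cons_val', Matrix.cons_val_zero,
      Matrix.cons_val_one, Matrix.cons_val_fin_one]
    push_cast
    field_simp
    ring
  have hBσ : ((B • σ : ℍ) : ℂ) = (((A • τ : ℍ) : ℂ) + k) / p := by
    have hb' : (A 0 1 : ℂ) + k * A 1 1 - l * (A 0 0 + k * A 1 0) = p * b := mod_cast hb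
    rw [coe_SL_smul, coe_SL_smul, hden]
    simp only [B, hσ, Matrix.of_apply, Matrix.cons_val', Matrix.cons_val_zero,
      Matrix.cons_val_one, Matrix.cons_val_fin_one]
    push_cast
    field_simp
    linear_combination -hb'
  have hχ : nebentypus p (B 1 1) = nebentypus p (A 1 1) := by
    refine nebentypus_congr ?_
    change (p : ℤ) ∣ A 1 1 - l * A 1 0 - A 1 1
    rw [sub_sub_cancel_left, dvd_neg]
    exact (mem_Gamma0_iff_dvd.mp hA).mul_left _
  rw [← hBσ, fEta_smul hp hm hB, hden, hχ, hσ]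

lemma gComp_zero_eq_sum_zmod (p m : ℕ) [NeZero p] (τ : ℂ) :
    gComp p m 0 τ = (1 / (p : ℂ)) * ∑ k : ZMod p, fEta p m ((τ + (k.val : ℤ)) / p) := by
  rw [gComp]
  congr 1
  refine Finset.sum_bij' (fun k _ => (k : ZMod p)) (fun k _ => k.val) (fun _ _ => Finset.mem_univ _)
    (fun k _ => Finset.mem_range.mpr (ZMod.val_lt k))
    (fun k hk => ZMod.val_cast_of_lt (Finset.mem_range.mp hk))
    (fun k _ => ZMod.natCast_rightInverse k) fun k hk => ?_
  rw [ZMod.val_cast_of_lt (Finset.mem_range.mp hk)]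
  simp [ee]

lemma gComp_zero_smul {p m : ℕ} [NeZero p] (hp : p = 2 ∨ p = 3 ∨ p = 5 ∨ p = 7)
    (hm : (p + 1) * m = 24) {A : SL(2, ℤ)} (hA : A ∈ CongruenceSubgroup.Gamma0 p) (τ : ℍ) :
    gComp p m 0 ((A • τ : ℍ) : ℂ) = nebentypus p (A 1 1)
      * ((A 1 0 : ℂ) * τ + A 1 1) ^ (-(m : ℤ)) * gComp p m 0 τ := by
  rw [gComp_zero_eq_sum_zmod, gComp_zero_eq_sum_zmod, mul_left_comm]
  congr 1
  rw [Finset.mul_sum]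
  have hc : ((A 1 0 : ℤ) : ZMod p) = 0 := CongruenceSubgroup.Gamma0_mem.mp hA
  have had : ((A 0 0 : ℤ) : ZMod p) * (A 1 1 : ℤ) = 1 := by
    have h := congrArg (Int.cast : ℤ → ZMod p) (SL_det A)
    push_cast at h
    rwa [hc, mul_zero, sub_zero] at h
  let φ : ZMod p → ZMod p := fun k => (A 1 1 : ℤ) * ((A 0 1 : ℤ) + k * (A 1 1 : ℤ))
  have hφ : Function.Bijective φ := Finite.injective_iff_bijective.mp fun k l hkl => by
    simp only [φ] at hkl
    linear_combination ((A 0 0 : ℤ) : ZMod p) ^ 2 * hkl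
      - (k - l) * (((A 0 0 : ℤ) : ZMod p) * (A 1 1 : ℤ) + 1) * had
  refine Fintype.sum_bijective φ hφ _ _ fun k => ?_
  refine fEta_smul_add_div hp hm hA τ ?_
  rw [← ZMod.intCast_zmod_eq_zero_iff_dvd]
  push_cast
  simp only [ZMod.natCast_val, ZMod.cast_id', id_eq, hc, φ]
  linear_combination (-((A 0 1 : ℤ) + k * (A 1 1 : ℤ) : ZMod p)) * had

end Modularity

section Lift

lemma ee_add_intCast (x : ℂ) (n : ℤ) : ee (x + n) = ee x := by
  rw [ee, ee, mul_add, Complex.exp_add, mul_comm _ (n : ℂ), Complex.exp_int_mul_two_pi_mul_I,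
    mul_one]

lemma ee_neg_two_mul_div_eight (m : ℕ) : ee (-(((2 * m : ℕ) : ℚ) / 8)) * Complex.I ^ m = 1 := by
  have hI : Complex.I = Complex.exp (Real.pi / 2 * Complex.I) := Complex.exp_pi_div_two_mul_I.symm
  conv_lhs => rw [hI]
  rw [ee, ← Complex.exp_nat_mul, ← Complex.exp_add, ← Complex.exp_zero]
  congr 1
  push_cast
  ring

lemma liftF_eq {p m j : ℕ} [NeZero p] (Dd : DiscForm p m) {γ : Dd.D}
    (hγ : ∃ z : ℤ, (z : ℚ) = Dd.qf γ + (j : ℚ) / p) {τ : ℂ} (hτ : 0 < τ.im) :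
    liftF p m Dd γ τ = (if γ = 0 then fEta p m τ else 0) + gComp p m j τ := by
  obtain ⟨z, hz⟩ := hγ
  have hp0 : 0 < p := Nat.pos_of_neZero p
  have hpc : (p : ℂ) ≠ 0 := NeZero.ne _
  have hsqrt : ((Real.sqrt ((p : ℝ) ^ (m + 2)) : ℝ) : ℂ) = (Real.sqrt p : ℂ) ^ m * p := by
    rw [pow_add, Real.sqrt_mul' _ (by positivity), Real.sqrt_sq (by positivity)]
    rw [show (p : ℝ) ^ m = (Real.sqrt p ^ m) ^ 2 by
      rw [← pow_mul, mul_comm, pow_mul, Real.sq_sqrt (by positivity)],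
      Real.sqrt_sq (by positivity)]
    push_cast
    rfl
  have hsp : (Real.sqrt p : ℂ) ^ m ≠ 0 := pow_ne_zero _ (by
    simpa using (Real.sqrt_pos.mpr (Nat.cast_pos.mpr hp0)).ne')
  rw [liftF, gComp, hsqrt, Finset.mul_sum, Finset.mul_sum]
  congr 1
  refine Finset.sum_congr rfl fun k _ => ?_
  have hee : ee ((k : ℚ) * Dd.qf γ) = ee (-(((k * j : ℕ) : ℚ) / p : ℚ)) := by
    conv_rhs => rw [← ee_add_intCast _ ((k : ℤ) * z)]
    congr 1
    have hz' : (z : ℂ) = (Dd.qf γ : ℂ) + (j : ℂ) / p := by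
      simpa using congrArg (Rat.cast : ℚ → ℂ) hz
    push_cast
    rw [hz']
    ring
  rw [pow_mul_fEta_neg_one_div hp0 m (by simpa using hτ), hee]
  have h8 := ee_neg_two_mul_div_eight m
  field_simp
  linear_combination (fEta p m ((τ + k) / p)) * ee (-(((k * j : ℕ) : ℚ) / p : ℚ)) * h8

end Lift

/-- the lift `F` of `f` to `Λ_p ⊕ √p II_{1,1}` has components
`F_0 = f + g_0` and `F_γ = g_j` for `γ ≠ 0` with `γ²/2 ≡ −j/p (mod 1)`; the components
with `γ²/2 ≡ 0 (mod 1)` are modular forms for `Γ₀(p)` of weight `−m`, with nontrivial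
quadratic character `(d/7)` in the case `p = 7`. -/
theorem lift_components_and_modularity
    (p m : ℕ) [NeZero p] (hp : p = 2 ∨ p = 3 ∨ p = 5 ∨ p = 7)
    (hm : (p + 1) * m = 24) (Dd : DiscForm p m) :
    -- F_0 = f + g_0
    (∀ τ : UpperHalfPlane,
      liftF p m Dd 0 (τ : ℂ) = fEta p m (τ : ℂ) + gComp p m 0 (τ : ℂ)) ∧
    -- F_γ = g_j if γ ≠ 0 and γ²/2 = −j/p mod 1
    (∀ (γ : Dd.D) (j : Fin p), γ ≠ 0 →
      (∃ z : ℤ, (z : ℚ) = Dd.qf γ + (j.1 : ℚ) / p) →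
      ∀ τ : UpperHalfPlane, liftF p m Dd γ (τ : ℂ) = gComp p m j.1 (τ : ℂ)) ∧
    -- the components with γ²/2 = 0 mod 1 are modular forms for Γ₀(p) of weight −m
    -- (with character (d/7) for p = 7)
    (∀ γ : Dd.D, (∃ z : ℤ, (z : ℚ) = Dd.qf γ) →
      ∀ A ∈ CongruenceSubgroup.Gamma0 p, ∀ τ : UpperHalfPlane,
        liftF p m Dd γ ((A • τ : UpperHalfPlane) : ℂ)
          = (if p = 7 then (chiSeven ((A : Matrix (Fin 2) (Fin 2) ℤ) 1 1) : ℂ) else 1)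
            * (((A : Matrix (Fin 2) (Fin 2) ℤ) 1 0 : ℂ) * (τ : ℂ)
                + ((A : Matrix (Fin 2) (Fin 2) ℤ) 1 1 : ℂ)) ^ (-(m : ℤ))
            * liftF p m Dd γ (τ : ℂ)) := by
  have h2 : ∀ (γ : Dd.D) (j : Fin p), γ ≠ 0 → (∃ z : ℤ, (z : ℚ) = Dd.qf γ + (j.1 : ℚ) / p) →
      ∀ τ : UpperHalfPlane, liftF p m Dd γ (τ : ℂ) = gComp p m j.1 (τ : ℂ) :=
    fun γ j hγ hj τ => by rw [liftF_eq Dd hj τ.im_pos, if_neg hγ, zero_add]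
  have h1 : ∀ τ : UpperHalfPlane,
      liftF p m Dd 0 (τ : ℂ) = fEta p m (τ : ℂ) + gComp p m 0 (τ : ℂ) := fun τ => by
    obtain ⟨z, hz⟩ := Dd.qf_quadratic 0 0
    rw [liftF_eq Dd (j := 0) ⟨z, by simpa using hz⟩ τ.im_pos, if_pos rfl]
  refine ⟨h1, h2, fun γ hγ A hA τ => ?_⟩
  have hf := fEta_smul hp hm hA τ
  have hg := gComp_zero_smul hp hm hA τ
  unfold nebentypus at hf hg
  rcases eq_or_ne γ 0 with rfl | hγ0
  · rw [h1, h1, hf, hg, mul_add]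
  · have hj : ∃ z : ℤ, (z : ℚ) = Dd.qf γ + ((0 : Fin p).1 : ℚ) / p := by simpa using hγ
    rw [h2 γ 0 hγ0 hj, h2 γ 0 hγ0 hj]
    exact hg
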